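/- Let T be a continuous t-norm on [0,1] with dual t-conorm S, and let γ = ⟨μ_γ, ν_γ⟩ be an intuitionistic fuzzy value. Then for all reals ξ, ζ > 0: (ξ_T γ) ⊕_T (ζ_T γ) = (ξ+ζ)_T γ and (γ^(ξ_T)) ⊗_T (γ^(ζ_T)) = γ^((ξ+ζ)_T). -/

import Mathlib

open Set

/-- A t-norm on `[0,1]`: commutative, associative, nondecreasing in each argument,
with neutral element `1`. -/
structure IsTnorm (T : ℝ → ℝ → ℝ) : Prop where
  maps_to : ∀ x ∈ Icc (0:ℝ) 1, ∀ y ∈ Icc (0:ℝ) 1, T x y ∈ Icc (0:ℝ) 1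
  comm : ∀ x ∈ Icc (0:ℝ) 1, ∀ y ∈ Icc (0:ℝ) 1, T x y = T y x
  assoc : ∀ x ∈ Icc (0:ℝ) 1, ∀ y ∈ Icc (0:ℝ) 1, ∀ z ∈ Icc (0:ℝ) 1,
    T (T x y) z = T x (T y z)
  mono : ∀ x ∈ Icc (0:ℝ) 1, ∀ y ∈ Icc (0:ℝ) 1, ∀ z ∈ Icc (0:ℝ) 1,
    y ≤ z → T x y ≤ T x z
  one : ∀ x ∈ Icc (0:ℝ) 1, T x 1 = x

/-- A t-conorm on `[0,1]`: commutative, associative, nondecreasing in each argument,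
with neutral element `0`. -/
structure IsTconorm (S : ℝ → ℝ → ℝ) : Prop where
  maps_to : ∀ x ∈ Icc (0:ℝ) 1, ∀ y ∈ Icc (0:ℝ) 1, S x y ∈ Icc (0:ℝ) 1
  comm : ∀ x ∈ Icc (0:ℝ) 1, ∀ y ∈ Icc (0:ℝ) 1, S x y = S y x
  assoc : ∀ x ∈ Icc (0:ℝ) 1, ∀ y ∈ Icc (0:ℝ) 1, ∀ z ∈ Icc (0:ℝ) 1,
    S (S x y) z = S x (S y z)
  mono : ∀ x ∈ Icc (0:ℝ) 1, ∀ y ∈ Icc (0:ℝ) 1, ∀ z ∈ Icc (0:ℝ) 1,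
    y ≤ z → S x y ≤ S x z
  zero : ∀ x ∈ Icc (0:ℝ) 1, S x 0 = x

/-- Continuity of a binary operation on the unit square. -/
def ContinuousOn2 (T : ℝ → ℝ → ℝ) : Prop :=
  ContinuousOn (fun p : ℝ × ℝ => T p.1 p.2) (Icc (0:ℝ) 1 ×ˢ Icc (0:ℝ) 1)

/-- `n`-fold power `u_T^(n)` with respect to a t-norm: `u_T^(0) = 1`,
`u_T^(n+1) = T (u_T^(n)) u`. -/
def Tpow (T : ℝ → ℝ → ℝ) (u : ℝ) : ℕ → ℝ
  | 0 => 1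
  | n + 1 => T (Tpow T u n) u

/-- `n`-fold power `u_S^(n)` with respect to a t-conorm: `u_S^(0) = 0`,
`u_S^(n+1) = S (u_S^(n)) u`. -/
def Spow (S : ℝ → ℝ → ℝ) (u : ℝ) : ℕ → ℝ
  | 0 => 0
  | n + 1 => S (Spow S u n) u

/-- `p`-th root `u_T^(1/p) = sup {v ∈ [0,1] | v_T^(p) < u}`. -/
noncomputable def Troot (T : ℝ → ℝ → ℝ) (u : ℝ) (p : ℕ) : ℝ :=
  sSup {v ∈ Icc (0:ℝ) 1 | Tpow T v p < u}

/-- `p`-th root `u_S^(1/p) = inf {v ∈ [0,1] | v_S^(p) > u}`. -/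
noncomputable def Sroot (S : ℝ → ℝ → ℝ) (u : ℝ) (p : ℕ) : ℝ :=
  sInf {v ∈ Icc (0:ℝ) 1 | u < Spow S v p}

/-- Rational power `u_T^(q/p) = (u_T^(1/p))_T^(q)`, with `r = q/p` in lowest terms. -/
noncomputable def TratPow (T : ℝ → ℝ → ℝ) (u : ℝ) (r : ℚ) : ℝ :=
  Tpow T (Troot T u r.den) r.num.toNat

/-- Rational power `u_S^(q/p) = (u_S^(1/p))_S^(q)`, with `r = q/p` in lowest terms. -/
noncomputable def SratPow (S : ℝ → ℝ → ℝ) (u : ℝ) (r : ℚ) : ℝ :=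
  Spow S (Sroot S u r.den) r.num.toNat

/-- Real power `u_T^(t) = inf {u_T^(r) | r ∈ [0,t] ∩ ℚ}`. -/
noncomputable def TrePow (T : ℝ → ℝ → ℝ) (u : ℝ) (t : ℝ) : ℝ :=
  sInf (TratPow T u '' {r : ℚ | 0 ≤ r ∧ (r : ℝ) ≤ t})

/-- Real power `u_S^(t) = sup {u_S^(r) | r ∈ [0,t] ∩ ℚ}`. -/
noncomputable def SrePow (S : ℝ → ℝ → ℝ) (u : ℝ) (t : ℝ) : ℝ :=
  sSup (SratPow S u '' {r : ℚ | 0 ≤ r ∧ (r : ℝ) ≤ t})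

/-- A t-norm is Archimedean if for all `x, y ∈ (0,1)` there is `n` with `x_T^(n) < y`. -/
def TnormArchimedean (T : ℝ → ℝ → ℝ) : Prop :=
  ∀ x ∈ Ioo (0:ℝ) 1, ∀ y ∈ Ioo (0:ℝ) 1, ∃ n : ℕ, Tpow T x n < y

/-- Strict monotonicity of a t-norm: `T x y < T x z` whenever `x > 0` and `y < z`. -/
def TnormStrictMono (T : ℝ → ℝ → ℝ) : Prop :=
  ∀ x ∈ Icc (0:ℝ) 1, 0 < x → ∀ y ∈ Icc (0:ℝ) 1, ∀ z ∈ Icc (0:ℝ) 1, y < z → T x y < T x z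

/-- Pseudo-inverse of a decreasing `G : [0,1] → [0,∞]`:
`G^(−1)(y) = sup {x ∈ [0,1] | G x > y}`. -/
noncomputable def pseudoInv (G : ℝ → ENNReal) (y : ENNReal) : ℝ :=
  sSup {x ∈ Icc (0:ℝ) 1 | y < G x}

/-- `G : [0,1] → [0,∞]` is an additive generator of the t-norm `T`. -/
structure IsAddGen (T : ℝ → ℝ → ℝ) (G : ℝ → ENNReal) : Prop where
  strictAnti : StrictAntiOn G (Icc (0:ℝ) 1)
  rightContinuousAtZero : ContinuousWithinAt G (Icc (0:ℝ) 1) 0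
  map_one : G 1 = 0
  sum_mem : ∀ x ∈ Icc (0:ℝ) 1, ∀ y ∈ Icc (0:ℝ) 1,
    G x + G y ∈ G '' Icc (0:ℝ) 1 ∪ Icc (G 0) ⊤
  eq_pseudoInv : ∀ x ∈ Icc (0:ℝ) 1, ∀ y ∈ Icc (0:ℝ) 1, T x y = pseudoInv G (G x + G y)

open Filter Topology

namespace IsTnorm

variable {T : ℝ → ℝ → ℝ} {u v w x y x' y' : ℝ}

theorem mono₂ (hT : IsTnorm T) (hx : x ∈ Icc (0:ℝ) 1) (hy : y ∈ Icc (0:ℝ) 1)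
    (hx' : x' ∈ Icc (0:ℝ) 1) (hy' : y' ∈ Icc (0:ℝ) 1) (hxx : x ≤ x') (hyy : y ≤ y') :
    T x y ≤ T x' y' :=
  calc T x y ≤ T x y' := hT.mono x hx y hy y' hy' hyy
    _ = T y' x := hT.comm x hx y' hy'
    _ ≤ T y' x' := hT.mono y' hy' x hx x' hx' hxx
    _ = T x' y' := hT.comm y' hy' x' hx'

theorem le_left (hT : IsTnorm T) (hx : x ∈ Icc (0:ℝ) 1) (hy : y ∈ Icc (0:ℝ) 1) : T x y ≤ x :=
  (hT.mono x hx y hy 1 (by simp) hy.2).trans_eq (hT.one x hx)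

theorem one_left (hT : IsTnorm T) (hx : x ∈ Icc (0:ℝ) 1) : T 1 x = x := by
  rw [hT.comm 1 (by simp) x hx, hT.one x hx]

theorem zero_right (hT : IsTnorm T) (hx : x ∈ Icc (0:ℝ) 1) : T x 0 = 0 := by
  have h0 : (0:ℝ) ∈ Icc (0:ℝ) 1 := by simp
  refine le_antisymm ?_ (hT.maps_to x hx 0 h0).1
  rw [hT.comm x hx 0 h0]
  exact hT.le_left h0 hx

theorem pow_mem (hT : IsTnorm T) (hv : v ∈ Icc (0:ℝ) 1) (n : ℕ) : Tpow T v n ∈ Icc (0:ℝ) 1 := by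
  induction n with
  | zero => simp [Tpow]
  | succ n ih => exact hT.maps_to _ ih _ hv

theorem pow_add (hT : IsTnorm T) (hv : v ∈ Icc (0:ℝ) 1) (m n : ℕ) :
    Tpow T v (m + n) = T (Tpow T v m) (Tpow T v n) := by
  induction n with
  | zero => exact (hT.one _ (hT.pow_mem hv m)).symm
  | succ n ih =>
    change T (Tpow T v (m + n)) v = T (Tpow T v m) (T (Tpow T v n) v)
    rw [ih, hT.assoc _ (hT.pow_mem hv m) _ (hT.pow_mem hv n) _ hv]

theorem pow_mul (hT : IsTnorm T) (hv : v ∈ Icc (0:ℝ) 1) (m n : ℕ) :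
    Tpow T v (m * n) = Tpow T (Tpow T v m) n := by
  induction n with
  | zero => rfl
  | succ n ih => rw [Nat.mul_succ, hT.pow_add hv, ih, Tpow]

theorem pow_mono (hT : IsTnorm T) (hv : v ∈ Icc (0:ℝ) 1) (hw : w ∈ Icc (0:ℝ) 1) (hvw : v ≤ w)
    (n : ℕ) : Tpow T v n ≤ Tpow T w n := by
  induction n with
  | zero => exact le_rfl
  | succ n ih => exact hT.mono₂ (hT.pow_mem hv n) hv (hT.pow_mem hw n) hw ih hvw

theorem one_pow (hT : IsTnorm T) (n : ℕ) : Tpow T 1 n = 1 := by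
  induction n with
  | zero => rfl
  | succ n ih => rw [Tpow, ih, hT.one 1 (by simp)]

theorem zero_pow (hT : IsTnorm T) {n : ℕ} (hn : 0 < n) : Tpow T 0 n = 0 := by
  obtain ⟨n, rfl⟩ := Nat.exists_eq_succ_of_ne_zero hn.ne'
  exact hT.zero_right (hT.pow_mem (by simp) n)

theorem continuousOn_pow (hT : IsTnorm T) (hTc : ContinuousOn2 T) (n : ℕ) :
    ContinuousOn (fun v => Tpow T v n) (Icc 0 1) := by
  induction n with
  | zero => exact continuousOn_const
  | succ n ih =>
    exact ContinuousOn.comp (g := fun p : ℝ × ℝ => T p.1 p.2) hTc (ih.prodMk continuousOn_id)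
      fun v hv => ⟨hT.pow_mem hv n, hv⟩

theorem tendsto (hTc : ContinuousOn2 T) {a b : ℕ → ℝ} (ha : ∀ n, a n ∈ Icc (0:ℝ) 1)
    (hb : ∀ n, b n ∈ Icc (0:ℝ) 1) (hx : x ∈ Icc (0:ℝ) 1) (hy : y ∈ Icc (0:ℝ) 1)
    (hax : Tendsto a atTop (𝓝 x)) (hby : Tendsto b atTop (𝓝 y)) :
    Tendsto (fun n => T (a n) (b n)) atTop (𝓝 (T x y)) :=
  Tendsto.comp (g := fun p : ℝ × ℝ => T p.1 p.2) (hTc (x, y) ⟨hx, hy⟩)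
    (tendsto_nhdsWithin_iff.2 ⟨hax.prodMk_nhds hby, Eventually.of_forall fun n => ⟨ha n, hb n⟩⟩)

/-- An idempotent of a continuous t-norm acts as the identity below itself. -/
theorem eq_of_le_idempotent (hT : IsTnorm T) (hTc : ContinuousOn2 T) (hx : x ∈ Icc (0:ℝ) 1)
    (hy : y ∈ Icc (0:ℝ) 1) (hyy : T y y = y) (hxy : x ≤ y) : T y x = x := by
  have hc : ContinuousOn (fun z => T y z) (Icc 0 1) :=
    ContinuousOn.comp (g := fun p : ℝ × ℝ => T p.1 p.2) hTc
      (continuousOn_const.prodMk continuousOn_id) fun z hz => ⟨hy, hz⟩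
  obtain ⟨z, hz, rfl⟩ := intermediate_value_Icc zero_le_one hc
    (show x ∈ Icc (T y 0) (T y 1) by rw [hT.zero_right hy, hT.one y hy]; exact ⟨hx.1, hxy⟩)
  change T y (T y z) = T y z
  rw [← hT.assoc y hy y hy z hz, hyy]

theorem isLeast_root (hT : IsTnorm T) (hTc : ContinuousOn2 T) (hu : u ∈ Icc (0:ℝ) 1) (p : ℕ) :
    IsLeast {v ∈ Icc (0:ℝ) 1 | u ≤ Tpow T v p} (Troot T u p) := by
  set A := {v ∈ Icc (0:ℝ) 1 | u ≤ Tpow T v p} with hA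
  have hclosed : IsClosed A :=
    isClosed_Icc.isClosed_le continuousOn_const (hT.continuousOn_pow hTc p)
  have hne : A.Nonempty := ⟨1, by simp, by rw [hT.one_pow]; exact hu.2⟩
  have hbdd : BddBelow A := ⟨0, fun v hv => hv.1.1⟩
  have hm : IsLeast A (sInf A) := hclosed.isLeast_csInf hne hbdd
  have hset : {v ∈ Icc (0:ℝ) 1 | Tpow T v p < u} = Ico 0 (sInf A) := by
    ext v
    constructor
    · rintro ⟨hv, hlt⟩
      refine ⟨hv.1, lt_of_not_ge fun hle => hlt.not_ge ?_⟩
      exact hm.1.2.trans (hT.pow_mono hm.1.1 hv hle p)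
    · rintro ⟨hv0, hvm⟩
      have hv : v ∈ Icc (0:ℝ) 1 := ⟨hv0, hvm.le.trans hm.1.1.2⟩
      exact ⟨hv, lt_of_not_ge fun hle => hvm.not_ge (hm.2 ⟨hv, hle⟩)⟩
  have hroot : Troot T u p = sInf A := by
    rw [Troot, hset]
    rcases hm.1.1.1.eq_or_lt with h | h
    · simp [← h]
    · exact csSup_Ico h
  rwa [hroot]

theorem root_mem (hT : IsTnorm T) (hTc : ContinuousOn2 T) (hu : u ∈ Icc (0:ℝ) 1) (p : ℕ) :
    Troot T u p ∈ Icc (0:ℝ) 1 :=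
  (hT.isLeast_root hTc hu p).1.1

theorem root_pow (hT : IsTnorm T) (hTc : ContinuousOn2 T) (hu : u ∈ Icc (0:ℝ) 1)
    {p : ℕ} (hp : 0 < p) : Tpow T (Troot T u p) p = u := by
  have hm := hT.isLeast_root hTc hu p
  refine le_antisymm ?_ hm.1.2
  obtain ⟨w, hw, hwu⟩ := intermediate_value_Icc zero_le_one (hT.continuousOn_pow hTc p)
    (show u ∈ Icc (Tpow T 0 p) (Tpow T 1 p) by rwa [hT.zero_pow hp, hT.one_pow])
  exact (hT.pow_mono hm.1.1 hw (hm.2 ⟨hw, hwu.ge⟩) p).trans_eq hwu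

theorem root_mul_pow (hT : IsTnorm T) (hTc : ContinuousOn2 T) (hu : u ∈ Icc (0:ℝ) 1)
    {p k : ℕ} (hp : 0 < p) (hk : 0 < k) : Tpow T (Troot T u (p * k)) k = Troot T u p := by
  have hpk := hT.isLeast_root hTc hu (p * k)
  have hr := hT.root_mem hTc hu p
  refine le_antisymm ?_ ?_
  · have hs := hT.root_mem hTc hr k
    have hsk := hT.root_pow hTc hr hk
    rw [← hsk]
    refine hT.pow_mono hpk.1.1 hs (hpk.2 ⟨hs, ?_⟩) k
    rw [mul_comm, hT.pow_mul hs, hsk, hT.root_pow hTc hu hp]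
  · refine (hT.isLeast_root hTc hu p).2 ⟨hT.pow_mem hpk.1.1 k, ?_⟩
    rw [← hT.pow_mul hpk.1.1, mul_comm k p]
    exact hpk.1.2

theorem ratPow_mem (hT : IsTnorm T) (hTc : ContinuousOn2 T) (hu : u ∈ Icc (0:ℝ) 1) (r : ℚ) :
    TratPow T u r ∈ Icc (0:ℝ) 1 :=
  hT.pow_mem (hT.root_mem hTc hu r.den) _

/-- Rational powers may be computed from any fraction representing the exponent. -/
theorem ratPow_eq (hT : IsTnorm T) (hTc : ContinuousOn2 T) (hu : u ∈ Icc (0:ℝ) 1) {r : ℚ}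
    {a n : ℕ} (hn : 0 < n) (hr : r = a / n) : TratPow T u r = Tpow T (Troot T u n) a := by
  have hr0 : 0 ≤ r := by rw [hr]; positivity
  have hnum : ((r.num.toNat : ℕ) : ℤ) = r.num := Int.toNat_of_nonneg (Rat.num_nonneg.2 hr0)
  have hnq : (n : ℚ) ≠ 0 := by positivity
  have hdvd : r.den ∣ n := by
    have h := Rat.den_dvd (a : ℤ) (n : ℤ)
    rw [Rat.divInt_eq_div] at h
    push_cast at h
    rw [← hr] at h
    exact_mod_cast h
  obtain ⟨k, rfl⟩ := hdvd
  have hk : 0 < k := Nat.pos_of_mul_pos_left hn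
  have ha : a = k * r.num.toNat := by
    have hd : (r.den : ℚ) ≠ 0 := by exact_mod_cast r.den_nz
    have h1 : (a : ℚ) = r * (r.den * k : ℕ) := by
      rw [eq_div_iff hnq] at hr; exact hr.symm
    have h2 : r * r.den = (r.num.toNat : ℕ) := by
      rw [Rat.mul_den_eq_num]; exact_mod_cast hnum.symm
    have h3 : (a : ℚ) = (k * r.num.toNat : ℕ) := by
      rw [h1]; push_cast; rw [← mul_assoc, h2]; ring
    exact_mod_cast h3
  rw [ha, hT.pow_mul (hT.root_mem hTc hu _), hT.root_mul_pow hTc hu r.den_pos hk, TratPow]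

theorem ratPow_add (hT : IsTnorm T) (hTc : ContinuousOn2 T) (hu : u ∈ Icc (0:ℝ) 1) {r s : ℚ}
    (hr : 0 ≤ r) (hs : 0 ≤ s) : TratPow T u (r + s) = T (TratPow T u r) (TratPow T u s) := by
  have key : ∀ q : ℚ, 0 ≤ q → q = (q.num.toNat : ℚ) / q.den := fun q hq => by
    have h : ((q.num.toNat : ℕ) : ℤ) = q.num := Int.toNat_of_nonneg (Rat.num_nonneg.2 hq)
    have h' : ((q.num.toNat : ℕ) : ℚ) = q.num := by exact_mod_cast h
    rw [h', Rat.num_div_den]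
  have hn : 0 < r.den * s.den := Nat.mul_pos r.den_pos s.den_pos
  have hrd : (r.den : ℚ) ≠ 0 := by exact_mod_cast r.den_nz
  have hsd : (s.den : ℚ) ≠ 0 := by exact_mod_cast s.den_nz
  have er : r = ((r.num.toNat * s.den : ℕ) : ℚ) / ((r.den * s.den : ℕ) : ℚ) := by
    conv_lhs => rw [key r hr]
    push_cast
    field_simp
  have es : s = ((s.num.toNat * r.den : ℕ) : ℚ) / ((r.den * s.den : ℕ) : ℚ) := by
    conv_lhs => rw [key s hs]
    push_cast
    field_simp
  have ers : r + s = ((r.num.toNat * s.den + s.num.toNat * r.den : ℕ) : ℚ) /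
      ((r.den * s.den : ℕ) : ℚ) := by
    rw [Nat.cast_add, add_div, ← er, ← es]
  rw [hT.ratPow_eq hTc hu hn er, hT.ratPow_eq hTc hu hn es, hT.ratPow_eq hTc hu hn ers,
    hT.pow_add (hT.root_mem hTc hu _)]

theorem ratPow_antitone (hT : IsTnorm T) (hTc : ContinuousOn2 T) (hu : u ∈ Icc (0:ℝ) 1) {r s : ℚ}
    (hr : 0 ≤ r) (hrs : r ≤ s) : TratPow T u s ≤ TratPow T u r := by
  rw [← add_sub_cancel r s, hT.ratPow_add hTc hu hr (sub_nonneg.2 hrs)]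
  exact hT.le_left (hT.ratPow_mem hTc hu r) (hT.ratPow_mem hTc hu _)

/-- Left continuity of rational powers in the exponent. -/
theorem le_ratPow_of_forall_lt (hT : IsTnorm T) (hTc : ContinuousOn2 T) (hu : u ∈ Icc (0:ℝ) 1)
    {q : ℚ} (hq : 0 < q) {c : ℝ} (hc : c ∈ Icc (0:ℝ) 1)
    (h : ∀ r : ℚ, 0 ≤ r → r < q → c ≤ TratPow T u r) : c ≤ TratPow T u q := by
  let g : ℕ → ℝ := fun n => TratPow T u (q / 2 ^ (n + 1))
  have hg : ∀ n, g n ∈ Icc (0:ℝ) 1 := fun n => hT.ratPow_mem hTc hu _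
  have hhalf : ∀ n : ℕ, q / 2 ^ (n + 1) + q / 2 ^ (n + 1) = q / 2 ^ n := fun n => by
    rw [pow_succ]; field_simp; norm_num
  have hpos : ∀ n : ℕ, 0 < q / 2 ^ n := fun n => by positivity
  have hmono : Monotone g := monotone_nat_of_le_succ fun n =>
    hT.ratPow_antitone hTc hu (hpos _).le (by linarith [hhalf (n + 1), hpos (n + 1 + 1)])
  have hbdd : BddAbove (range g) := ⟨1, by rintro _ ⟨n, rfl⟩; exact (hg n).2⟩
  have hlim : Tendsto g atTop (𝓝 (⨆ n, g n)) := tendsto_atTop_ciSup hmono hbdd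
  set e := ⨆ n, g n
  have hge : ∀ n, g n ≤ e := fun n => le_ciSup hbdd n
  have he : e ∈ Icc (0:ℝ) 1 := ⟨(hg 0).1.trans (hge 0), ciSup_le fun n => (hg n).2⟩
  have hsq : ∀ n, T (g (n + 1)) (g (n + 1)) = g n := fun n => by
    rw [← hT.ratPow_add hTc hu (hpos _).le (hpos _).le, hhalf]
  have hlim' := hlim.comp (tendsto_add_atTop_nat 1)
  have hidem : T e e = e := by
    refine tendsto_nhds_unique
      (tendsto hTc (fun n => hg (n + 1)) (fun n => hg (n + 1)) he he hlim' hlim') ?_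
    simpa only [hsq] using hlim
  have hce : c ≤ e := by
    refine (h (q / 2 ^ 1) (hpos 1).le ?_).trans (hge 0)
    rw [pow_one]
    exact half_lt_self hq
  have hcq : ∀ n, T c (g n) ≤ TratPow T u q := fun n => by
    have hle : q / 2 ^ (n + 1) ≤ q :=
      div_le_self hq.le (one_le_pow₀ (by norm_num))
    have hsub : 0 ≤ q - q / 2 ^ (n + 1) := sub_nonneg.2 hle
    calc T c (g n) ≤ T (TratPow T u (q - q / 2 ^ (n + 1))) (g n) :=
          hT.mono₂ hc (hg n) (hT.ratPow_mem hTc hu _) (hg n)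
            (h _ hsub (by linarith [hpos (n + 1)])) le_rfl
      _ = TratPow T u q := by
          rw [← hT.ratPow_add hTc hu hsub (hpos _).le, sub_add_cancel]
  have hce' : T c e = c := by
    rw [hT.comm c hc e he, hT.eq_of_le_idempotent hTc hc he hidem hce]
  rw [← hce']
  exact le_of_tendsto (tendsto hTc (fun _ => hc) hg hc he tendsto_const_nhds hlim)
    (Eventually.of_forall hcq)

theorem isGLB_rePow (hT : IsTnorm T) (hTc : ContinuousOn2 T) (hu : u ∈ Icc (0:ℝ) 1) {t : ℝ}
    (ht : 0 ≤ t) :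
    IsGLB (TratPow T u '' {r : ℚ | 0 ≤ r ∧ (r : ℝ) ≤ t}) (TrePow T u t) :=
  isGLB_csInf ⟨_, 0, ⟨le_rfl, by simpa using ht⟩, rfl⟩
    ⟨0, by rintro _ ⟨r, -, rfl⟩; exact (hT.ratPow_mem hTc hu r).1⟩

theorem rePow_mem (hT : IsTnorm T) (hTc : ContinuousOn2 T) (hu : u ∈ Icc (0:ℝ) 1) {t : ℝ}
    (ht : 0 ≤ t) : TrePow T u t ∈ Icc (0:ℝ) 1 := by
  have h := hT.isGLB_rePow hTc hu ht
  refine ⟨h.2 ?_, (h.1 ⟨0, ⟨le_rfl, by simpa using ht⟩, rfl⟩).trans (hT.ratPow_mem hTc hu 0).2⟩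
  rintro _ ⟨r, -, rfl⟩
  exact (hT.ratPow_mem hTc hu r).1

theorem rePow_add (hT : IsTnorm T) (hTc : ContinuousOn2 T) (hu : u ∈ Icc (0:ℝ) 1) {s t : ℝ}
    (hs : 0 < s) (ht : 0 < t) : T (TrePow T u s) (TrePow T u t) = TrePow T u (s + t) := by
  have hGs := hT.isGLB_rePow hTc hu hs.le
  have hGt := hT.isGLB_rePow hTc hu ht.le
  have hGst := hT.isGLB_rePow hTc hu (add_pos hs ht).le
  have hms := hT.rePow_mem hTc hu hs.le
  have hmt := hT.rePow_mem hTc hu ht.le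
  refine le_antisymm (hGst.2 ?_) ?_
  · have hlt : ∀ q : ℚ, 0 ≤ q → (q : ℝ) < s + t →
        T (TrePow T u s) (TrePow T u t) ≤ TratPow T u q := by
      intro q hq0 hq
      obtain ⟨r, hr0, hrq, hrs, hqr⟩ :
          ∃ r : ℚ, 0 ≤ r ∧ r ≤ q ∧ (r : ℝ) ≤ s ∧ (q : ℝ) - r ≤ t := by
        rcases hq0.eq_or_lt with rfl | hpos
        · exact ⟨0, le_rfl, le_rfl, by simpa using hs.le, by simpa using ht.le⟩
        · have hpos' : (0:ℝ) < q := by exact_mod_cast hpos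
          obtain ⟨r, h1, h2⟩ := exists_rat_btwn (show max 0 ((q:ℝ) - t) < min s q from
            max_lt (lt_min hs hpos') (lt_min (by linarith) (by linarith)))
          rw [max_lt_iff] at h1
          rw [lt_min_iff] at h2
          exact ⟨r, by exact_mod_cast h1.1.le, by exact_mod_cast h2.2.le, h2.1.le,
            by linarith [h1.2]⟩
      have hsub : 0 ≤ q - r := sub_nonneg.2 hrq
      rw [← add_sub_cancel r q, hT.ratPow_add hTc hu hr0 hsub]
      exact hT.mono₂ hms hmt (hT.ratPow_mem hTc hu _) (hT.ratPow_mem hTc hu _)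
        (hGs.1 ⟨r, ⟨hr0, hrs⟩, rfl⟩) (hGt.1 ⟨q - r, ⟨hsub, by push_cast; exact hqr⟩, rfl⟩)
    rintro _ ⟨q, ⟨hq0, hq⟩, rfl⟩
    rcases hq.eq_or_lt with hq | hq
    · have hqpos : 0 < q := by
        have : (0:ℝ) < q := by rw [hq]; exact add_pos hs ht
        exact_mod_cast this
      refine hT.le_ratPow_of_forall_lt hTc hu hqpos (hT.maps_to _ hms _ hmt) fun r hr0 hr => ?_
      exact hlt r hr0 (by rw [← hq]; exact_mod_cast hr)
    · exact hlt q hq0 hq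
  · have hne : ∀ {x : ℝ}, 0 < x →
        (TratPow T u '' {r : ℚ | 0 ≤ r ∧ (r : ℝ) ≤ x}).Nonempty := fun hx =>
      ⟨_, 0, ⟨le_rfl, by simpa using hx.le⟩, rfl⟩
    obtain ⟨a, -, -, ha, haS⟩ := hGs.exists_seq_antitone_tendsto (hne hs)
    obtain ⟨b, -, -, hb, hbT⟩ := hGt.exists_seq_antitone_tendsto (hne ht)
    have hI : ∀ {x y : ℝ}, y ∈ TratPow T u '' {r : ℚ | 0 ≤ r ∧ (r : ℝ) ≤ x} →
        y ∈ Icc (0:ℝ) 1 := by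
      rintro x _ ⟨r, -, rfl⟩
      exact hT.ratPow_mem hTc hu r
    refine ge_of_tendsto (tendsto hTc (fun n => hI (haS n)) (fun n => hI (hbT n)) hms hmt ha hb)
      (Eventually.of_forall fun n => ?_)
    obtain ⟨r, ⟨hr0, hr⟩, hra⟩ := haS n
    obtain ⟨q, ⟨hq0, hq⟩, hqb⟩ := hbT n
    rw [← hra, ← hqb, ← hT.ratPow_add hTc hu hr0 hq0]
    exact hGst.1 ⟨r + q, ⟨add_nonneg hr0 hq0, by push_cast; exact add_le_add hr hq⟩, rfl⟩

end IsTnorm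

section Dual

variable {T S : ℝ → ℝ → ℝ} {u : ℝ}

theorem Spow_eq_one_sub_Tpow (hdual : ∀ x y : ℝ, S x y = 1 - T (1 - x) (1 - y)) (n : ℕ) :
    Spow S u n = 1 - Tpow T (1 - u) n := by
  induction n with
  | zero => simp [Spow, Tpow]
  | succ n ih => rw [Spow, Tpow, hdual, ih, sub_sub_cancel]

theorem Sroot_eq_one_sub_Troot (hT : IsTnorm T) (hTc : ContinuousOn2 T)
    (hdual : ∀ x y : ℝ, S x y = 1 - T (1 - x) (1 - y)) (hu0 : 0 ≤ u) (hu1 : u < 1)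
    {p : ℕ} (hp : 0 < p) : Sroot S u p = 1 - Troot T (1 - u) p := by
  have hm := hT.isLeast_root hTc (u := 1 - u) ⟨by linarith, by linarith⟩ p
  set m := Troot T (1 - u) p
  have hmpos : 0 < m := by
    refine hm.1.1.1.lt_of_ne fun h => ?_
    have := hm.1.2
    rw [← h, hT.zero_pow hp] at this
    linarith
  have hset : {v ∈ Icc (0:ℝ) 1 | u < Spow S v p} = Ioc (1 - m) 1 := by
    ext v
    simp only [mem_ofPred_eq, Spow_eq_one_sub_Tpow hdual]
    constructor
    · rintro ⟨hv, hlt⟩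
      refine ⟨lt_of_not_ge fun hle => ?_, hv.2⟩
      have := hm.1.2.trans (hT.pow_mono hm.1.1 (w := 1 - v) ⟨by linarith [hv.2], by linarith [hv.1]⟩
        (by linarith) p)
      linarith
    · rintro ⟨hv, hv1⟩
      have hv0 : 0 ≤ v := by linarith [hm.1.1.2]
      refine ⟨⟨hv0, hv1⟩, lt_of_not_ge fun hle => ?_⟩
      have := hm.2 (show 1 - v ∈ _ from ⟨⟨by linarith, by linarith⟩, by linarith⟩)
      linarith
  rw [Sroot, hset, csInf_Ioc (by linarith)]

theorem SrePow_eq_one_sub_TrePow (hT : IsTnorm T) (hTc : ContinuousOn2 T)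
    (hdual : ∀ x y : ℝ, S x y = 1 - T (1 - x) (1 - y)) (hu0 : 0 ≤ u) (hu1 : u < 1)
    {t : ℝ} (ht : 0 ≤ t) : SrePow S u t = 1 - TrePow T (1 - u) t := by
  have hrat : ∀ r : ℚ, SratPow S u r = 1 - TratPow T (1 - u) r := fun r => by
    rw [SratPow, TratPow, Sroot_eq_one_sub_Troot hT hTc hdual hu0 hu1 r.den_pos,
      Spow_eq_one_sub_Tpow hdual, sub_sub_cancel]
  have hG := hT.isGLB_rePow hTc (u := 1 - u) ⟨by linarith, by linarith⟩ ht
  refine IsLUB.csSup_eq ⟨?_, fun b hb => ?_⟩ ⟨_, 0, ⟨le_rfl, by simpa using ht⟩, rfl⟩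
  · rintro _ ⟨r, hr, rfl⟩
    rw [hrat]
    exact sub_le_sub_left (hG.1 ⟨r, hr, rfl⟩) 1
  · have : 1 - b ≤ TrePow T (1 - u) t := hG.2 <| by
      rintro _ ⟨r, hr, rfl⟩
      have := hb ⟨r, hr, rfl⟩
      rw [hrat] at this
      linarith
    linarith

/-- At `u = 1` the set defining `Sroot` is empty, so its real `sInf` is `0` and all powers
vanish. -/
theorem SrePow_one (hT : IsTnorm T)
    (hdual : ∀ x y : ℝ, S x y = 1 - T (1 - x) (1 - y)) {t : ℝ} (ht : 0 ≤ t) :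
    SrePow S 1 t = 0 := by
  have hroot : ∀ p, Sroot S 1 p = 0 := fun p => by
    have : {v ∈ Icc (0:ℝ) 1 | 1 < Spow S v p} = ∅ := by
      refine eq_empty_of_forall_notMem fun v hv => ?_
      have h := hv.2
      rw [Spow_eq_one_sub_Tpow hdual] at h
      linarith [(hT.pow_mem (v := 1 - v) ⟨by linarith [hv.1.2], by linarith [hv.1.1]⟩ p).1]
    rw [Sroot, this, Real.sInf_empty]
  have hrat : ∀ r, SratPow S 1 r = 0 := fun r => by
    rw [SratPow, hroot, Spow_eq_one_sub_Tpow hdual, sub_zero, hT.one_pow, sub_self]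
  have hne : {r : ℚ | 0 ≤ r ∧ (r : ℝ) ≤ t}.Nonempty := ⟨0, le_rfl, by simpa using ht⟩
  have himage : SratPow S 1 '' {r : ℚ | 0 ≤ r ∧ (r : ℝ) ≤ t} = {0} :=
    (image_congr fun r _ => hrat r).trans (hne.image_const 0)
  rw [SrePow, himage, csSup_singleton]

theorem SrePow_add (hT : IsTnorm T) (hTc : ContinuousOn2 T)
    (hdual : ∀ x y : ℝ, S x y = 1 - T (1 - x) (1 - y)) (hu : u ∈ Icc (0:ℝ) 1) {s t : ℝ}
    (hs : 0 < s) (ht : 0 < t) : S (SrePow S u s) (SrePow S u t) = SrePow S u (s + t) := by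
  have hst := add_pos hs ht
  rcases hu.2.eq_or_lt with rfl | hu1
  · simp only [SrePow_one hT hdual hs.le, SrePow_one hT hdual ht.le,
      SrePow_one hT hdual hst.le]
    rw [hdual, sub_zero, hT.one 1 (by simp), sub_self]
  · rw [SrePow_eq_one_sub_TrePow hT hTc hdual hu.1 hu1 hs.le,
      SrePow_eq_one_sub_TrePow hT hTc hdual hu.1 hu1 ht.le,
      SrePow_eq_one_sub_TrePow hT hTc hdual hu.1 hu1 hst.le, hdual, sub_sub_cancel,
      sub_sub_cancel, hT.rePow_add hTc ⟨by linarith, by linarith [hu.1]⟩ hs ht]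

end Dual

/-- For a continuous t-norm `T` with dual t-conorm `S` and an
intuitionistic fuzzy value `γ = ⟨μ, ν⟩`, one has
`(ξ_T γ) ⊕_T (ζ_T γ) = (ξ+ζ)_T γ` and `(γ^(ξ_T)) ⊗_T (γ^(ζ_T)) = γ^((ξ+ζ)_T)`,
stated componentwise. -/
theorem ifv_scalar_add_pow (T S : ℝ → ℝ → ℝ) (hT : IsTnorm T) (hTc : ContinuousOn2 T)
    (hdual : ∀ x y : ℝ, S x y = 1 - T (1 - x) (1 - y))
    (μ ν : ℝ) (hγ : μ ∈ Icc (0:ℝ) 1 ∧ ν ∈ Icc (0:ℝ) 1 ∧ μ + ν ≤ 1)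
    (ξ ζ : ℝ) (hξ : 0 < ξ) (hζ : 0 < ζ) :
    S (SrePow S μ ξ) (SrePow S μ ζ) = SrePow S μ (ξ + ζ) ∧
    T (TrePow T ν ξ) (TrePow T ν ζ) = TrePow T ν (ξ + ζ) ∧
    T (TrePow T μ ξ) (TrePow T μ ζ) = TrePow T μ (ξ + ζ) ∧
    S (SrePow S ν ξ) (SrePow S ν ζ) = SrePow S ν (ξ + ζ) := by
  exact ⟨SrePow_add hT hTc hdual hγ.1 hξ hζ, hT.rePow_add hTc hγ.2.1 hξ hζ,
    hT.rePow_add hTc hγ.1 hξ hζ, SrePow_add hT hTc hdual hγ.2.1 hξ hζ⟩
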